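/- Suppose m is the Dirac point mass at α ∈ (0,1), and let x > 0. Then the function G*(z) := k*·1_{z ≥ α} on (0,1), where k* := x / ∫_α^1 F_ρ^{-1}(1-z) dz, is a feasible quantile function, its objective value equals k* = x / ∫_α^1 F_ρ^{-1}(1-z) dz, and its objective value is greater than or equal to that of every feasible quantile function; i.e., it is optimal. -/

import Mathlib

open MeasureTheory Set Filter Topology ENNReal

noncomputable section

/-- The CDF of a random variable `ρ` under the measure `μ`. -/
def cdfFun {Ω : Type*} [MeasurableSpace Ω] (μ : Measure Ω) (ρ : Ω → ℝ) : ℝ → ℝ :=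
  fun t => (μ {ω | ρ ω ≤ t}).toReal

/-- The right-continuous quantile function of `ρ`:
`F_ρ⁻¹(z) = inf {t : F_ρ(t) > z}`. -/
def rcInv {Ω : Type*} [MeasurableSpace Ω] (μ : Measure Ω) (ρ : Ω → ℝ) : ℝ → ℝ :=
  fun z => sInf {t : ℝ | z < cdfFun μ ρ t}

/-- A feasible quantile function for pricing-density `F = F_ρ⁻¹` and initial wealth `x`:
nondecreasing and right-continuous on `(0,1)`, with `lim_{z↓0} G(z) ≥ 0`, satisfying the
budget constraint `∫_0^1 F(1-z) G(z) dz ≤ x`. -/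
def Feasible (F : ℝ → ℝ) (x : ℝ) (G : ℝ → ℝ) : Prop :=
  MonotoneOn G (Set.Ioo 0 1)
  ∧ (∀ z ∈ Set.Ioo (0:ℝ) 1, Filter.Tendsto G (nhdsWithin z (Set.Ioi z)) (nhds (G z)))
  ∧ (∃ L, 0 ≤ L ∧ Filter.Tendsto G (nhdsWithin 0 (Set.Ioi 0)) (nhds L))
  ∧ ∫⁻ z in Set.Ioo (0:ℝ) 1, ENNReal.ofReal (F (1 - z) * G z) ≤ ENNReal.ofReal x

/-- The extension `Ḡ` of a (nonnegative) quantile function `G` from `(0,1)` to `[0,1]`,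
valued in `[0,∞]`, with `Ḡ(0) = lim_{z↓0} G(z)` and `Ḡ(1) = lim_{z↑1} G(z)`
(these limits are the inf/sup over `(0,1)` since `G` is nondecreasing). -/
def Gbar (G : ℝ → ℝ) : ℝ → ℝ≥0∞ := fun z =>
  if z = 0 then ⨅ y ∈ Set.Ioo (0:ℝ) 1, ENNReal.ofReal (G y)
  else if z = 1 then ⨆ y ∈ Set.Ioo (0:ℝ) 1, ENNReal.ofReal (G y)
  else ENNReal.ofReal (G z)

/-- The objective value `∫_{[0,1]} Ḡ(z) m(dz)` of a quantile function `G`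
(for `m` a Borel probability measure carried by `[0,1]`). -/
def objVal (m : Measure ℝ) (G : ℝ → ℝ) : ℝ≥0∞ := ∫⁻ z, Gbar G z ∂m

/-- `ζ(c) = m([c,1]) / ∫_c^1 F(1-z) dz`. -/
def zeta (F : ℝ → ℝ) (m : Measure ℝ) (c : ℝ) : ℝ :=
  (m (Set.Icc c 1)).toReal / ∫ z in c..1, F (1 - z)

/-- The right-continuous quantile function of a positive random variable with continuous CDF is
positive on `(0,1)`. -/
lemma rcInv_pos {Ω : Type*} [MeasurableSpace Ω] {μ : Measure Ω} [IsProbabilityMeasure μ]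
    {ρ : Ω → ℝ} (hρmeas : Measurable ρ) (hρpos : ∀ ω, 0 < ρ ω)
    (hcdf : Continuous (cdfFun μ ρ)) {z : ℝ} (hz : z ∈ Ioo (0 : ℝ) 1) :
    0 < rcInv μ ρ z := by
  have hmono : Monotone (cdfFun μ ρ) := fun s t hst =>
    ENNReal.toReal_mono (measure_ne_top _ _) (measure_mono fun ω (hω : ρ ω ≤ s) => hω.trans hst)
  have hzero : cdfFun μ ρ 0 = 0 := by
    have hempty : {ω | ρ ω ≤ 0} = ∅ := by
      ext ω
      simp [hρpos ω]
    simp [cdfFun, hempty]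
  have hne : {t : ℝ | z < cdfFun μ ρ t}.Nonempty := by
    have : IsProbabilityMeasure (μ.map ρ) :=
      Measure.isProbabilityMeasure_map hρmeas.aemeasurable
    have heq : cdfFun μ ρ = ProbabilityTheory.cdf (μ.map ρ) := by
      ext t
      rw [ProbabilityTheory.cdf_eq_real, measureReal_def,
        Measure.map_apply hρmeas measurableSet_Iic]
      rfl
    have hlim := ProbabilityTheory.tendsto_cdf_atTop (μ.map ρ)
    rw [← heq] at hlim
    exact (hlim.eventually (lt_mem_nhds hz.2)).exists
  have hnear : ∀ᶠ t in 𝓝 (0 : ℝ), cdfFun μ ρ t < z :=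
    hcdf.continuousAt.eventually (gt_mem_nhds (by rw [hzero]; exact hz.1))
  obtain ⟨ε, hε, hball⟩ := Metric.eventually_nhds_iff.1 hnear
  have hhalf : cdfFun μ ρ (ε / 2) < z := by
    apply hball
    rw [Real.dist_eq, sub_zero, abs_of_pos (half_pos hε)]
    exact half_lt_self hε
  refine (half_pos hε).trans_le (le_csInf hne fun t (ht : z < cdfFun μ ρ t) => ?_)
  by_contra! hlt
  exact absurd (ht.trans_le (hmono hlt.le)) hhalf.not_gt

/-- For nonnegative integrable `f` on `[a,b)` and `c ≥ 0`, the lower Lebesgue integral of `f * c`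
is the interval integral times `c`. -/
lemma setLIntegral_Ico_ofReal_mul_const {f : ℝ → ℝ} {a b c : ℝ} (hab : a ≤ b) (hc : 0 ≤ c)
    (hf : IntervalIntegrable f volume a b) (hpos : ∀ z ∈ Ico a b, 0 ≤ f z) :
    ∫⁻ z in Ico a b, ENNReal.ofReal (f z * c) = ENNReal.ofReal ((∫ z in a..b, f z) * c) := by
  have hint : IntegrableOn f (Ico a b) :=
    hf.1.congr_set_ae Ico_ae_eq_Ioc
  rw [intervalIntegral.integral_of_le hab, integral_Ioc_eq_integral_Ioo,
    ← integral_Ico_eq_integral_Ioo, ← integral_mul_const]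
  refine (ofReal_integral_eq_lintegral_ofReal (hint.mul_const c) ?_).symm
  filter_upwards [ae_restrict_mem measurableSet_Ico] with z hz
  exact mul_nonneg (hpos z hz) hc

/-- A step function `k · 1_{z ≥ α}` is right-continuous. -/
lemma tendsto_ite_le_nhdsGT (α k z : ℝ) :
    Tendsto (fun y => if α ≤ y then k else 0) (𝓝[>] z) (𝓝 (if α ≤ z then k else 0)) := by
  refine tendsto_const_nhds.congr' ?_
  by_cases h : α ≤ z
  · filter_upwards [self_mem_nhdsWithin] with y (hy : z < y)
    rw [if_pos h, if_pos (h.trans hy.le)]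
  · filter_upwards [nhdsWithin_le_nhds (gt_mem_nhds (not_le.1 h))] with y hy
    rw [if_neg h, if_neg hy.not_ge]

/-- The objective value under a Dirac mass at an interior point is the quantile there. -/
lemma objVal_dirac {α : ℝ} (hα : α ∈ Ioo (0 : ℝ) 1) (G : ℝ → ℝ) :
    objVal (Measure.dirac α) G = ENNReal.ofReal (G α) := by
  simp [objVal, Gbar, hα.1.ne', hα.2.ne]

/-- if `m` is the Dirac point mass at `α ∈ (0,1)` (quantile maximization),
then `G*(z) = k*·1_{z ≥ α}` with `k* = x / ∫_α^1 F_ρ⁻¹(1-z) dz` is a feasible quantile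
function, its objective value equals `k*`, and it is optimal among feasible quantile
functions. -/
theorem quantile_maximization_optimal
    {Ω : Type*} [MeasurableSpace Ω] (μ : Measure Ω) [IsProbabilityMeasure μ]
    (ρ : Ω → ℝ) (hρmeas : Measurable ρ) (hρpos : ∀ ω, 0 < ρ ω)
    (hρint : Integrable ρ μ) (hcdf : Continuous (cdfFun μ ρ))
    (x δ : ℝ) (hx : 0 < x) (hδpos : 0 < δ)
    (hδ1 : δ = ∫ ω, ρ ω ∂μ) (hδ2 : δ = ∫ z in (0:ℝ)..1, rcInv μ ρ (1 - z))
    (α : ℝ) (hα : α ∈ Set.Ioo (0:ℝ) 1)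
    (m : Measure ℝ) (hmdirac : m = Measure.dirac α) :
    Feasible (rcInv μ ρ) x
        (fun z => if α ≤ z then x / ∫ t in α..1, rcInv μ ρ (1 - t) else 0)
    ∧ objVal m (fun z => if α ≤ z then x / ∫ t in α..1, rcInv μ ρ (1 - t) else 0)
        = ENNReal.ofReal (x / ∫ t in α..1, rcInv μ ρ (1 - t))
    ∧ ∀ G : ℝ → ℝ, Feasible (rcInv μ ρ) x G →
        objVal m G ≤
          objVal m (fun z => if α ≤ z then x / ∫ t in α..1, rcInv μ ρ (1 - t) else 0) := by
  subst hmdirac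
  have hpos : ∀ z ∈ Ioo (0 : ℝ) 1, 0 < rcInv μ ρ (1 - z) := fun z hz =>
    rcInv_pos hρmeas hρpos hcdf ⟨by linarith [hz.2], by linarith [hz.1]⟩
  have hint : IntervalIntegrable (fun z => rcInv μ ρ (1 - z)) volume 0 1 := by
    by_contra h
    rw [intervalIntegral.integral_undef h] at hδ2
    exact hδpos.ne' hδ2
  have hintα : IntervalIntegrable (fun z => rcInv μ ρ (1 - z)) volume α 1 := by
    refine hint.mono_set ?_
    rw [uIcc_of_le hα.2.le, uIcc_of_le zero_le_one]
    exact Icc_subset_Icc_left hα.1.le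
  have hI : 0 < ∫ t in α..1, rcInv μ ρ (1 - t) :=
    intervalIntegral.intervalIntegral_pos_of_pos_on hintα
      (fun z hz => hpos z ⟨hα.1.trans hz.1, hz.2⟩) hα.2
  have hlint : ∀ c : ℝ, 0 ≤ c → ∫⁻ z in Ico α 1, ENNReal.ofReal (rcInv μ ρ (1 - z) * c) =
      ENNReal.ofReal ((∫ t in α..1, rcInv μ ρ (1 - t)) * c) := fun c hc =>
    setLIntegral_Ico_ofReal_mul_const hα.2.le hc hintα
      fun z hz => (hpos z ⟨hα.1.trans_le hz.1, hz.2⟩).le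
  set I := ∫ t in α..1, rcInv μ ρ (1 - t)
  have hk : 0 ≤ x / I := (div_pos hx hI).le
  refine ⟨⟨?_, fun z _ => tendsto_ite_le_nhdsGT α (x / I) z, ⟨0, le_rfl, ?_⟩, ?_⟩, ?_, ?_⟩
  · intro y _ z _ hyz
    dsimp only
    split_ifs with h₁ h₂
    · exact le_rfl
    · exact absurd (h₁.trans hyz) h₂
    · exact hk
    · exact le_rfl
  · simpa [hα.1.not_ge] using tendsto_ite_le_nhdsGT α (x / I) 0
  · have hind : ∀ z, ENNReal.ofReal (rcInv μ ρ (1 - z) * if α ≤ z then x / I else 0) =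
        (Ici α).indicator (fun z => ENNReal.ofReal (rcInv μ ρ (1 - z) * (x / I))) z := by
      intro z
      by_cases h : α ≤ z <;> simp [h]
    have hset : Ici α ∩ Ioo (0 : ℝ) 1 = Ico α 1 := by
      ext z
      simp only [mem_inter_iff, mem_Ici, mem_Ioo, mem_Ico]
      exact ⟨fun h => ⟨h.1, h.2.2⟩, fun h => ⟨h.1, hα.1.trans_le h.1, h.2⟩⟩
    simp_rw [hind]
    rw [setLIntegral_indicator measurableSet_Ici, hset, hlint _ hk, mul_div_cancel₀ x hI.ne']
  · rw [objVal_dirac hα, if_pos le_rfl]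
  · rintro G ⟨hmono, -, -, hbudget⟩
    rw [objVal_dirac hα, objVal_dirac hα, if_pos le_rfl]
    rcases le_total (G α) 0 with h | h
    · rw [ENNReal.ofReal_of_nonpos h]
      exact zero_le
    refine ENNReal.ofReal_le_ofReal ((le_div_iff₀' hI).2 ?_)
    rw [← ENNReal.ofReal_le_ofReal_iff hx.le, ← hlint _ h]
    calc ∫⁻ z in Ico α 1, ENNReal.ofReal (rcInv μ ρ (1 - z) * G α)
        ≤ ∫⁻ z in Ico α 1, ENNReal.ofReal (rcInv μ ρ (1 - z) * G z) := by
          refine setLIntegral_mono' measurableSet_Ico fun z hz => ENNReal.ofReal_le_ofReal ?_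
          have hz' : z ∈ Ioo (0 : ℝ) 1 := ⟨hα.1.trans_le hz.1, hz.2⟩
          exact mul_le_mul_of_nonneg_left (hmono hα hz' hz.1) (hpos z hz').le
      _ ≤ ∫⁻ z in Ioo (0 : ℝ) 1, ENNReal.ofReal (rcInv μ ρ (1 - z) * G z) :=
          lintegral_mono_set fun z hz => ⟨hα.1.trans_le hz.1, hz.2⟩
      _ ≤ ENNReal.ofReal x := hbudget
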